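/- Let A=(Q,Q0,Qf,Σ,Δ) be a 2NWA in weakly-hierarchical post form. There exists a deterministic and complete 2NWA A' whose linear states are subsets of (Q ∪ Q³) × Q × Q, with initial state {(q0,q0,q0) : q0 ∈ Q0}, such that for every 2-wave word ω of length n, every interval [s,f] ⊆ [n] that is without pending arch, and every states S, S' of A' such that the unique run of A' on ω restricted to [s,f] starts in S and ends in S', the following holds: for all r̄ ∈ Q ∪ Q³, r ∈ Q and q' ∈ Q, the triple (r̄,r,q') belongs to S' if and only if there exists q ∈ Q with (r̄,r,q) ∈ S and a run of A on ω restricted to [s,f] from q to q'. -/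

import Mathlib

/-- A matching relation of length `n`, on positions `1, …, n`. -/
structure Matching (n : ℕ) where
  rel : ℕ → ℕ → Prop
  ordered : ∀ i j, rel i j → 1 ≤ i ∧ i < j ∧ j ≤ n
  unique : ∀ i j k l, rel i j → rel k l →
    (i = k ∨ i = l ∨ j = k ∨ j = l) → i = k ∧ j = l
  noncrossing : ∀ i j k l, rel i j → rel k l → i < k → k < j → l < j

/-- A 2-nested word: a word together with two matchings of its length. -/
structure TwoNW (α : Type) where
  word : List α
  M1 : Matching word.length
  M2 : Matching word.length

def Matching.IsCall {n : ℕ} (M : Matching n) (i : ℕ) : Prop := ∃ j, M.rel i j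
def Matching.IsRet {n : ℕ} (M : Matching n) (i : ℕ) : Prop := ∃ j, M.rel j i
def Matching.IsInt {n : ℕ} (M : Matching n) (i : ℕ) : Prop := ¬ M.IsCall i ∧ ¬ M.IsRet i

/-- `(i1,i2,i3,i4)` is a 2-wave of the pair of matchings `(M1, M2)`. -/
def IsTwoWaveQuad {n : ℕ} (M1 M2 : Matching n) (i1 i2 i3 i4 : ℕ) : Prop :=
  i1 < i2 ∧ i2 < i3 ∧ i3 < i4 ∧
  M1.rel i1 i2 ∧ M1.rel i3 i4 ∧ M2.rel i2 i3 ∧ M2.rel i1 i4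

/-- A 2-wave structure: every arch of `M1 ∪ M2` is an arch of some 2-wave. -/
def IsWaveStructure {n : ℕ} (M1 M2 : Matching n) : Prop :=
  (∀ i j, M1.rel i j → ∃ i1 i2 i3 i4, IsTwoWaveQuad M1 M2 i1 i2 i3 i4 ∧
      ((i = i1 ∧ j = i2) ∨ (i = i3 ∧ j = i4))) ∧
  (∀ i j, M2.rel i j → ∃ i1 i2 i3 i4, IsTwoWaveQuad M1 M2 i1 i2 i3 i4 ∧
      ((i = i2 ∧ j = i3) ∨ (i = i1 ∧ j = i4)))

/-- A 2-wave word. -/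
def TwoNW.IsWaveWord {α : Type} (ω : TwoNW α) : Prop := IsWaveStructure ω.M1 ω.M2

/-- A 2-nested word automaton (2NWA); each transition table is presented as a
set of (input, output) pairs. -/
structure TwoNWA (α Q P : Type) where
  init : Set Q
  final : Set Q
  Δcc : Set ((Q × α) × (P × P × Q))
  Δrc : Set ((Q × P × α) × (P × Q))
  Δcr : Set ((Q × P × α) × (P × Q))
  Δrr : Set ((Q × P × P × α) × Q)
  Δci : Set ((Q × α) × (P × Q))
  Δic : Set ((Q × α) × (P × Q))
  Δri : Set ((Q × P × α) × Q)
  Δir : Set ((Q × P × α) × Q)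
  Δii : Set ((Q × α) × Q)

/-- The local run condition at position `i` (with `1 ≤ i ≤ |w|`): `ℓ` is the
sequence of linear states, and `h1 i` (resp. `h2 i`) is the hierarchical state
labelling the `M1`- (resp. `M2`-) arch whose call position is `i`. -/
def TwoNWA.RunAt {α Q P : Type} (A : TwoNWA α Q P) (ω : TwoNW α)
    (ℓ : ℕ → Q) (h1 h2 : ℕ → P) (i : ℕ) : Prop :=
  ∃ a, ω.word[i - 1]? = some a ∧
    ((ω.M1.IsCall i ∧ ω.M2.IsCall i ∧ ((ℓ (i-1), a), (h1 i, h2 i, ℓ i)) ∈ A.Δcc)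
   ∨ (∃ j, ω.M1.rel j i ∧ ω.M2.IsCall i ∧ ((ℓ (i-1), h1 j, a), (h2 i, ℓ i)) ∈ A.Δrc)
   ∨ (ω.M1.IsCall i ∧ (∃ j, ω.M2.rel j i ∧ ((ℓ (i-1), h2 j, a), (h1 i, ℓ i)) ∈ A.Δcr))
   ∨ (∃ j k, ω.M1.rel j i ∧ ω.M2.rel k i ∧ ((ℓ (i-1), h1 j, h2 k, a), ℓ i) ∈ A.Δrr)
   ∨ (ω.M1.IsCall i ∧ ω.M2.IsInt i ∧ ((ℓ (i-1), a), (h1 i, ℓ i)) ∈ A.Δci)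
   ∨ (ω.M1.IsInt i ∧ ω.M2.IsCall i ∧ ((ℓ (i-1), a), (h2 i, ℓ i)) ∈ A.Δic)
   ∨ (∃ j, ω.M1.rel j i ∧ ω.M2.IsInt i ∧ ((ℓ (i-1), h1 j, a), ℓ i) ∈ A.Δri)
   ∨ (ω.M1.IsInt i ∧ (∃ j, ω.M2.rel j i ∧ ((ℓ (i-1), h2 j, a), ℓ i) ∈ A.Δir))
   ∨ (ω.M1.IsInt i ∧ ω.M2.IsInt i ∧ ((ℓ (i-1), a), ℓ i) ∈ A.Δii))

def TwoNWA.IsRun {α Q P : Type} (A : TwoNWA α Q P) (ω : TwoNW α)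
    (ℓ : ℕ → Q) (h1 h2 : ℕ → P) : Prop :=
  ∀ i, 1 ≤ i → i ≤ ω.word.length → A.RunAt ω ℓ h1 h2 i

def TwoNWA.Accepts {α Q P : Type} (A : TwoNWA α Q P) (ω : TwoNW α) : Prop :=
  ∃ ℓ h1 h2, A.IsRun ω ℓ h1 h2 ∧ ℓ 0 ∈ A.init ∧ ℓ ω.word.length ∈ A.final

/-- The language of 2-nested words accepted by `A`. -/
def TwoNWA.lang {α Q P : Type} (A : TwoNWA α Q P) : Set (TwoNW α) :=
  { ω | A.Accepts ω }

/-- The language of 2-wave words accepted by `A`. -/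
def TwoNWA.langWW {α Q P : Type} (A : TwoNWA α Q P) : Set (TwoNW α) :=
  { ω | A.Accepts ω ∧ ω.IsWaveWord }

/-- There is a run of `A` on `ω` from linear state `q` to linear state `q'`. -/
def TwoNWA.Exec {α Q P : Type} (A : TwoNWA α Q P) (ω : TwoNW α) (q q' : Q) : Prop :=
  ∃ ℓ h1 h2, A.IsRun ω ℓ h1 h2 ∧ ℓ 0 = q ∧ ℓ ω.word.length = q'

/-- Deterministic 2NWA: a single initial state, and each transition table
induces a function from inputs to outputs. -/
def TwoNWA.Deterministic {α Q P : Type} (A : TwoNWA α Q P) : Prop :=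
  (∃ q0, A.init = {q0}) ∧
  (∀ x y y', (x, y) ∈ A.Δcc → (x, y') ∈ A.Δcc → y = y') ∧
  (∀ x y y', (x, y) ∈ A.Δrc → (x, y') ∈ A.Δrc → y = y') ∧
  (∀ x y y', (x, y) ∈ A.Δcr → (x, y') ∈ A.Δcr → y = y') ∧
  (∀ x y y', (x, y) ∈ A.Δrr → (x, y') ∈ A.Δrr → y = y') ∧
  (∀ x y y', (x, y) ∈ A.Δci → (x, y') ∈ A.Δci → y = y') ∧
  (∀ x y y', (x, y) ∈ A.Δic → (x, y') ∈ A.Δic → y = y') ∧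
  (∀ x y y', (x, y) ∈ A.Δri → (x, y') ∈ A.Δri → y = y') ∧
  (∀ x y y', (x, y) ∈ A.Δir → (x, y') ∈ A.Δir → y = y') ∧
  (∀ x y y', (x, y) ∈ A.Δii → (x, y') ∈ A.Δii → y = y')

/-- Complete 2NWA: each transition table provides an output for every input. -/
def TwoNWA.Complete {α Q P : Type} (A : TwoNWA α Q P) : Prop :=
  (∀ x, ∃ y, (x, y) ∈ A.Δcc) ∧ (∀ x, ∃ y, (x, y) ∈ A.Δrc) ∧
  (∀ x, ∃ y, (x, y) ∈ A.Δcr) ∧ (∀ x, ∃ y, (x, y) ∈ A.Δrr) ∧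
  (∀ x, ∃ y, (x, y) ∈ A.Δci) ∧ (∀ x, ∃ y, (x, y) ∈ A.Δic) ∧
  (∀ x, ∃ y, (x, y) ∈ A.Δri) ∧ (∀ x, ∃ y, (x, y) ∈ A.Δir) ∧
  (∀ x, ∃ y, (x, y) ∈ A.Δii)

/-- Weakly-hierarchical post form: hierarchical states are the linear states,
and every hierarchical output of a transition equals its target linear state. -/
def TwoNWA.PostForm {α Q : Type} (A : TwoNWA α Q Q) : Prop :=
  (∀ t ∈ A.Δcc, t.2.1 = t.2.2.2 ∧ t.2.2.1 = t.2.2.2) ∧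
  (∀ t ∈ A.Δrc, t.2.1 = t.2.2) ∧
  (∀ t ∈ A.Δcr, t.2.1 = t.2.2) ∧
  (∀ t ∈ A.Δci, t.2.1 = t.2.2) ∧
  (∀ t ∈ A.Δic, t.2.1 = t.2.2)

/-- Nice 2NWA: in every non-internal transition all hierarchical states
involved are equal. -/
def TwoNWA.Nice {α Q P : Type} (A : TwoNWA α Q P) : Prop :=
  (∀ t ∈ A.Δcc, t.2.1 = t.2.2.1) ∧
  (∀ t ∈ A.Δrc, t.1.2.1 = t.2.1) ∧
  (∀ t ∈ A.Δcr, t.1.2.1 = t.2.1) ∧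
  (∀ t ∈ A.Δrr, t.1.2.1 = t.1.2.2.1)

/-- A regular language of 2-nested words. -/
def RegularTwoNWL {α : Type} (L : Set (TwoNW α)) : Prop :=
  ∃ (Q P : Type) (_ : Finite Q) (_ : Finite P) (A : TwoNWA α Q P), A.lang = L

/-- `I` is without pending arch (wpa) w.r.t. `M`: calls and returns of `I` are
matched inside `I`. -/
def Matching.Wpa {n : ℕ} (M : Matching n) (I : Set ℕ) : Prop :=
  ∀ i ∈ I, ∀ j, (M.rel i j → j ∈ I) ∧ (M.rel j i → j ∈ I)

/-- `I` is without pending arch w.r.t. both matchings of `ω`. -/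
def TwoNW.WpaSet {α : Type} (ω : TwoNW α) (I : Set ℕ) : Prop :=
  ω.M1.Wpa I ∧ ω.M2.Wpa I

/-- Restriction of a matching to the window of `m` positions `d+1, …, d+m`,
renumbered `1, …, m`. -/
def Matching.restrict {n : ℕ} (M : Matching n) (d m : ℕ) : Matching m where
  rel i j := 1 ≤ i ∧ i < j ∧ j ≤ m ∧ M.rel (d + i) (d + j)
  ordered := fun i j h => ⟨h.1, h.2.1, h.2.2.1⟩
  unique := by
    rintro i j k l ⟨hi, hij, hj, hM⟩ ⟨hk, hkl, hl, hM'⟩ hc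
    have h2 := M.unique _ _ _ _ hM hM' (by omega)
    omega
  noncrossing := by
    rintro i j k l ⟨hi, hij, hj, hM⟩ ⟨hk, hkl, hl, hM'⟩ h1 h2
    have := M.noncrossing _ _ _ _ hM hM' (by omega) (by omega)
    omega

/-- Restriction `ω|[s,f]` of a 2-nested word to the interval `[s,f]`. -/
def TwoNW.restrict {α : Type} (ω : TwoNW α) (s f : ℕ) : TwoNW α :=
  { word := (ω.word.drop (s - 1)).take (f + 1 - s)
    M1 := ω.M1.restrict (s - 1) ((ω.word.drop (s - 1)).take (f + 1 - s)).length
    M2 := ω.M2.restrict (s - 1) ((ω.word.drop (s - 1)).take (f + 1 - s)).length }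

namespace Matching

variable {n : ℕ} {M : Matching n}

theorem not_isRet_of_isCall {i : ℕ} (h : M.IsCall i) : ¬ M.IsRet i := by
  rintro ⟨k, hk⟩
  obtain ⟨j, hj⟩ := h
  have h1 := M.unique _ _ _ _ hj hk (by simp)
  have h2 := M.ordered _ _ hj
  omega

theorem not_isInt_of_isCall {i : ℕ} (h : M.IsCall i) : ¬ M.IsInt i := fun h' => h'.1 h

theorem not_isInt_of_isRet {i : ℕ} (h : M.IsRet i) : ¬ M.IsInt i := fun h' => h'.2 h

theorem eq_of_rel_right {i j k : ℕ} (h : M.rel j i) (h' : M.rel k i) : k = j :=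
  (M.unique _ _ _ _ h' h (by simp)).1

theorem Wpa.union {I J : Set ℕ} (hI : M.Wpa I) (hJ : M.Wpa J) : M.Wpa (I ∪ J) := by
  rintro i (hi | hi) j
  · exact ⟨fun h => .inl ((hI i hi j).1 h), fun h => .inl ((hI i hi j).2 h)⟩
  · exact ⟨fun h => .inr ((hJ i hi j).1 h), fun h => .inr ((hJ i hi j).2 h)⟩

theorem Wpa.inter {I J : Set ℕ} (hI : M.Wpa I) (hJ : M.Wpa J) : M.Wpa (I ∩ J) :=
  fun i hi j => ⟨fun h => ⟨(hI i hi.1 j).1 h, (hJ i hi.2 j).1 h⟩,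
    fun h => ⟨(hI i hi.1 j).2 h, (hJ i hi.2 j).2 h⟩⟩

/-- The inside of an arch is without pending arch. -/
theorem wpa_Ioo {k l : ℕ} (h : M.rel k l) : M.Wpa (Set.Ioo k l) := by
  rintro i ⟨hi, hi'⟩ j
  refine ⟨fun hij => ?_, fun hij => ?_⟩
  · have h1 := M.ordered _ _ hij
    have h2 := M.noncrossing _ _ _ _ h hij hi hi'
    exact ⟨by omega, h2⟩
  · have h1 := M.ordered _ _ hij
    refine ⟨?_, by omega⟩
    by_contra hj
    rcases Nat.lt_or_ge j k with hjk | hjk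
    · have := M.noncrossing _ _ _ _ hij h hjk hi
      omega
    · have hjk : j = k := by omega
      have := M.unique _ _ _ _ hij h (by simp [hjk])
      omega

/-- Positions of a set without pending arch lying before an arch that ends at or after all of its
positions are without pending arch. -/
theorem Wpa.inter_Iio {J : Set ℕ} (hJ : M.Wpa J) {k l : ℕ} (h : M.rel k l)
    (hmax : ∀ j ∈ J, j ≤ l) : M.Wpa (J ∩ Set.Iio k) := by
  rintro i ⟨hi, hik⟩ j
  have hik : i < k := hik
  refine ⟨fun hij => ?_, fun hij => ?_⟩
  · have hjJ := (hJ i hi j).1 hij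
    refine ⟨hjJ, ?_⟩
    by_contra hj
    have hj : ¬ j < k := hj
    have h1 := hmax j hjJ
    rcases Nat.lt_or_ge k j with hkj | hkj
    · have := M.noncrossing _ _ _ _ hij h hik hkj
      omega
    · have := M.unique _ _ _ _ hij h (by right; right; left; omega)
      omega
  · have := M.ordered _ _ hij
    exact ⟨(hJ i hi j).2 hij, show j < k by omega⟩

/-- Removing an internal position keeps a set without pending arch. -/
theorem Wpa.inter_Iio_of_isInt {J : Set ℕ} (hJ : M.Wpa J) {d : ℕ} (hd : M.IsInt d)
    (hmax : ∀ j ∈ J, j ≤ d) : M.Wpa (J ∩ Set.Iio d) := by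
  rintro i ⟨hi, -⟩ j
  refine ⟨fun hij => ?_, fun hij => ?_⟩
  · have hjJ := (hJ i hi j).1 hij
    refine ⟨hjJ, lt_of_le_of_ne (hmax j hjJ) ?_⟩
    rintro rfl
    exact hd.2 ⟨i, hij⟩
  · have hjJ := (hJ i hi j).2 hij
    refine ⟨hjJ, lt_of_le_of_ne (hmax j hjJ) ?_⟩
    rintro rfl
    exact hd.1 ⟨i, hij⟩

theorem wpa_Ioc_zero : M.Wpa (Set.Ioc 0 n) := by
  intro i _ j
  refine ⟨fun h => ?_, fun h => ?_⟩ <;> have := M.ordered _ _ h <;>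
    exact ⟨by omega, by omega⟩

end Matching

namespace IsTwoWaveQuad

variable {n : ℕ} {M1 M2 : Matching n} {i₁ i₂ i₃ i₄ : ℕ}

/-- The inside of the two `M1`-arches of a 2-wave is without pending `M2`-arch. -/
theorem wpa_inner (h : IsTwoWaveQuad M1 M2 i₁ i₂ i₃ i₄) :
    M2.Wpa (Set.Ioo i₁ i₂ ∪ Set.Ioo i₃ i₄) := by
  obtain ⟨h12, h23, h34, h1, h2, h3, h4⟩ := h
  rintro i hi j
  have hi' : i₁ < i ∧ i < i₄ ∧ ¬ (i₂ ≤ i ∧ i ≤ i₃) := by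
    simp only [Set.mem_union, Set.mem_Ioo] at hi; omega
  suffices H : ∀ j, (M2.rel i j ∨ M2.rel j i) → j ∈ Set.Ioo i₁ i₄ ∧ j ∉ Set.Ioo i₂ i₃ ∧
      j ≠ i₂ ∧ j ≠ i₃ by
    have H' : ∀ j, (M2.rel i j ∨ M2.rel j i) → j ∈ Set.Ioo i₁ i₂ ∪ Set.Ioo i₃ i₄ := by
      intro j hj
      have := H j hj
      simp only [Set.mem_union, Set.mem_Ioo] at this ⊢
      omega
    exact ⟨fun h => H' j (.inl h), fun h => H' j (.inr h)⟩
  intro j hj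
  have hj4 : j ∈ Set.Ioo i₁ i₄ := by
    rcases hj with hj | hj
    · exact (Matching.wpa_Ioo h4 i ⟨hi'.1, hi'.2.1⟩ j).1 hj
    · exact (Matching.wpa_Ioo h4 i ⟨hi'.1, hi'.2.1⟩ j).2 hj
  have hj3 : j ∉ Set.Ioo i₂ i₃ := by
    intro hj3
    have : i ∈ Set.Ioo i₂ i₃ := by
      rcases hj with hj | hj
      · exact (Matching.wpa_Ioo h3 j hj3 i).2 hj
      · exact (Matching.wpa_Ioo h3 j hj3 i).1 hj
    exact hi'.2.2 ⟨this.1.le, this.2.le⟩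
  refine ⟨hj4, hj3, ?_, ?_⟩
  · rintro rfl
    rcases hj with hj | hj
    · have := M2.unique _ _ _ _ hj h3 (by simp); omega
    · have := M2.unique _ _ _ _ hj h3 (by simp); omega
  · rintro rfl
    rcases hj with hj | hj
    · have := M2.unique _ _ _ _ hj h3 (by simp); omega
    · have := M2.unique _ _ _ _ hj h3 (by simp); omega

end IsTwoWaveQuad

namespace TwoNW

variable {α : Type} {ω : TwoNW α} {J : Set ℕ} {i₁ i₂ i₃ i₄ : ℕ}

/-- An `M1`-arch inside a set `J` without pending arch cannot start before and end after the first
position of a 2-wave that ends at the last position of `J`. -/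
theorem IsWaveWord.lt_of_rel (hω : ω.IsWaveWord) (hJ : ω.WpaSet J)
    (hW : IsTwoWaveQuad ω.M1 ω.M2 i₁ i₂ i₃ i₄) (hmax : ∀ j ∈ J, j ≤ i₄) {x y : ℕ}
    (hx : x ∈ J) (hxy : ω.M1.rel x y) (hxi : x < i₁) : y < i₁ := by
  have h4 := hW.2.2.2.2.2.2
  have hy : y ∈ J := (hJ.1 x hx y).1 hxy
  have hlt := Matching.Wpa.inter_Iio hJ.2 h4 hmax
  obtain ⟨v₁, v₂, v₃, v₄, ⟨v12, v23, v34, -, -, -, v14⟩, hv⟩ := hω.1 x y hxy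
  rcases hv with ⟨rfl, rfl⟩ | ⟨rfl, rfl⟩
  · have : v₄ < i₁ := ((hlt x ⟨hx, hxi⟩ v₄).1 v14).2
    omega
  · have h1 : v₁ ∈ J := (hJ.2 y hy v₁).2 v14
    exact ((hlt v₁ ⟨h1, show v₁ < i₁ by omega⟩ y).1 v14).2

theorem IsWaveWord.wpa_before (hω : ω.IsWaveWord) (hJ : ω.WpaSet J)
    (hW : IsTwoWaveQuad ω.M1 ω.M2 i₁ i₂ i₃ i₄) (hmax : ∀ j ∈ J, j ≤ i₄) :
    ω.WpaSet (J ∩ Set.Iio i₁) := by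
  refine ⟨?_, Matching.Wpa.inter_Iio hJ.2 hW.2.2.2.2.2.2 hmax⟩
  rintro i ⟨hi, hik⟩ j
  refine ⟨fun hij => ⟨(hJ.1 i hi j).1 hij, hω.lt_of_rel hJ hW hmax hi hij hik⟩,
    fun hij => ⟨(hJ.1 i hi j).2 hij, ?_⟩⟩
  have := ω.M1.ordered _ _ hij
  have hik : i < i₁ := hik
  exact show j < i₁ by omega

theorem IsWaveWord.wpa_middle (hω : ω.IsWaveWord) (hJ : ω.WpaSet J)
    (hW : IsTwoWaveQuad ω.M1 ω.M2 i₁ i₂ i₃ i₄) (hmax : ∀ j ∈ J, j ≤ i₄) :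
    ω.WpaSet (J ∩ Set.Ioo i₂ i₃) := by
  have hbef := (hω.wpa_before hJ hW hmax).1
  obtain ⟨h12, h23, h34, h1, h2, h3, h4⟩ := hW
  refine ⟨?_, hJ.2.inter (Matching.wpa_Ioo h3)⟩
  rintro i ⟨hi, hi2, hi3⟩ j
  suffices H : ∀ j, (ω.M1.rel i j ∨ ω.M1.rel j i) → j ∈ J ∩ Set.Ioo i₂ i₃ from
    ⟨fun h => H j (.inl h), fun h => H j (.inr h)⟩
  intro j hj
  have hjJ : j ∈ J := by
    rcases hj with hj | hj
    · exact (hJ.1 i hi j).1 hj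
    · exact (hJ.1 i hi j).2 hj
  have key : ∀ I : Set ℕ, ω.M1.Wpa I → i ∉ I → j ∉ I := by
    intro I hI hiI hjI
    rcases hj with hj | hj
    · exact hiI ((hI j hjI i).2 hj)
    · exact hiI ((hI j hjI i).1 hj)
  have k1 := key _ hbef (fun h => by have : i < i₁ := h.2; omega)
  have k2 := key _ (Matching.wpa_Ioo h1) (fun h => by have := h.2; omega)
  have k3 := key _ (Matching.wpa_Ioo h2) (fun h => by have := h.1; omega)
  have hle := hmax j hjJ
  have ends : ∀ x y, ω.M1.rel x y → i ≠ x → i ≠ y → j ≠ x ∧ j ≠ y := by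
    intro x y hxy hix hiy
    rcases hj with hj | hj
    · exact ⟨fun e => hiy (by subst e; have := ω.M1.unique _ _ _ _ hj hxy (by simp)
                              exact absurd this.1 hix),
        fun e => hix (ω.M1.unique _ _ _ _ hj hxy (by simp [e])).1⟩
    · exact ⟨fun e => hiy (ω.M1.unique _ _ _ _ hj hxy (by simp [e])).2,
        fun e => hiy (ω.M1.unique _ _ _ _ hj hxy (by simp [e])).2⟩
  have e1 := ends _ _ h1 (by omega) (by omega)
  have e2 := ends _ _ h2 (by omega) (by omega)
  have k1 : ¬ j < i₁ := fun h => k1 ⟨hjJ, h⟩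
  simp only [Set.mem_Ioo] at k2 k3
  exact ⟨hjJ, show i₂ < j by omega, show j < i₃ by omega⟩

/-- The last position of a set without pending arch is either internal or the end of a 2-wave
contained in the set. -/
theorem IsWaveWord.last_position (hω : ω.IsWaveWord) (hJ : ω.WpaSet J) {d : ℕ} (hd : d ∈ J)
    (hmax : ∀ j ∈ J, j ≤ d) :
    (ω.M1.IsInt d ∧ ω.M2.IsInt d) ∨
      ∃ i₁ i₂ i₃, IsTwoWaveQuad ω.M1 ω.M2 i₁ i₂ i₃ d ∧ i₁ ∈ J ∧ i₂ ∈ J ∧ i₃ ∈ J := by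
  have c1 : ¬ ω.M1.IsCall d := fun ⟨j, hj⟩ => by
    have := ω.M1.ordered _ _ hj
    have := hmax j ((hJ.1 d hd j).1 hj)
    omega
  have c2 : ¬ ω.M2.IsCall d := fun ⟨j, hj⟩ => by
    have := ω.M2.ordered _ _ hj
    have := hmax j ((hJ.2 d hd j).1 hj)
    omega
  have wave : ∀ i₁ i₂ i₃, IsTwoWaveQuad ω.M1 ω.M2 i₁ i₂ i₃ d →
      ∃ i₁ i₂ i₃, IsTwoWaveQuad ω.M1 ω.M2 i₁ i₂ i₃ d ∧ i₁ ∈ J ∧ i₂ ∈ J ∧ i₃ ∈ J := by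
    rintro i₁ i₂ i₃ hW
    obtain ⟨-, -, -, h1, h2, -, h4⟩ := id hW
    have m1 := (hJ.2 d hd _).2 h4
    exact ⟨i₁, i₂, i₃, hW, m1, (hJ.1 _ m1 _).1 h1, (hJ.1 d hd _).2 h2⟩
  by_cases r1 : ω.M1.IsRet d
  · obtain ⟨k, hk⟩ := r1
    obtain ⟨v₁, v₂, v₃, v₄, hv, ⟨rfl, rfl⟩ | ⟨rfl, rfl⟩⟩ := hω.1 _ _ hk
    · exact absurd ⟨_, hv.2.2.2.2.2.1⟩ c2
    · exact .inr (wave _ _ _ hv)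
  · by_cases r2 : ω.M2.IsRet d
    · obtain ⟨k, hk⟩ := r2
      obtain ⟨v₁, v₂, v₃, v₄, hv, ⟨rfl, rfl⟩ | ⟨rfl, rfl⟩⟩ := hω.2 _ _ hk
      · exact absurd ⟨_, hv.2.2.2.2.1⟩ c1
      · exact .inr (wave _ _ _ hv)
    · exact .inl ⟨⟨c1, r1⟩, ⟨c2, r2⟩⟩

/-- The restriction of a 2-wave word to an interval without pending arch is a 2-wave word. -/
theorem IsWaveWord.restrict (hω : ω.IsWaveWord) {s f : ℕ} (hs : 1 ≤ s) (hf : f ≤ ω.word.length)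
    (hI : ω.WpaSet (Set.Icc s f)) : (ω.restrict s f).IsWaveWord := by
  have hlen : ((ω.word.drop (s - 1)).take (f + 1 - s)).length = f + 1 - s := by
    simp only [List.length_take, List.length_drop]; omega
  have quad : ∀ i₁ i₂ i₃ i₄, IsTwoWaveQuad ω.M1 ω.M2 i₁ i₂ i₃ i₄ → s ≤ i₁ → i₄ ≤ f →
      IsTwoWaveQuad (ω.restrict s f).M1 (ω.restrict s f).M2
        (i₁ - (s - 1)) (i₂ - (s - 1)) (i₃ - (s - 1)) (i₄ - (s - 1)) := by
    rintro i₁ i₂ i₃ i₄ ⟨h12, h23, h34, h1, h2, h3, h4⟩ hs1 hf4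
    have sh : ∀ i, s ≤ i → s - 1 + (i - (s - 1)) = i := by omega
    refine ⟨by omega, by omega, by omega, ⟨by omega, by omega, ?_, ?_⟩, ⟨by omega, by omega, ?_, ?_⟩,
      ⟨by omega, by omega, ?_, ?_⟩, ⟨by omega, by omega, ?_, ?_⟩⟩
    all_goals first
      | (rw [hlen]; omega)
      | (rw [sh _ (by omega), sh _ (by omega)]; assumption)
  constructor
  · rintro i j ⟨hi, hij, hj, h⟩
    change _ ≤ List.length _ at hj
    rw [hlen] at hj
    obtain ⟨v₁, v₂, v₃, v₄, hv, hcase⟩ := hω.1 _ _ h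
    obtain ⟨-, -, -, h1, h2, h3, h4⟩ := id hv
    have b : s ≤ v₁ ∧ v₄ ≤ f := by
      rcases hcase with ⟨e1, e2⟩ | ⟨e1, e2⟩
      · have m1 : v₁ ∈ Set.Icc s f := ⟨by omega, by omega⟩
        exact ⟨m1.1, ((hI.2 _ m1 _).1 h4).2⟩
      · have m1 : v₄ ∈ Set.Icc s f := ⟨by omega, by omega⟩
        exact ⟨((hI.2 _ m1 _).2 h4).1, m1.2⟩
    exact ⟨_, _, _, _, quad _ _ _ _ hv b.1 b.2, by omega⟩
  · rintro i j ⟨hi, hij, hj, h⟩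
    change _ ≤ List.length _ at hj
    rw [hlen] at hj
    obtain ⟨v₁, v₂, v₃, v₄, hv, hcase⟩ := hω.2 _ _ h
    obtain ⟨-, -, -, h1, h2, h3, h4⟩ := id hv
    have b : s ≤ v₁ ∧ v₄ ≤ f := by
      rcases hcase with ⟨e1, e2⟩ | ⟨e1, e2⟩
      · have m2 : v₂ ∈ Set.Icc s f := ⟨by omega, by omega⟩
        have m1 := (hI.1 _ m2 _).2 h1
        exact ⟨m1.1, ((hI.2 _ m1 _).1 h4).2⟩
      · have m1 : v₄ ∈ Set.Icc s f := ⟨by omega, by omega⟩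
        exact ⟨((hI.2 _ m1 _).2 h4).1, m1.2⟩
    exact ⟨_, _, _, _, quad _ _ _ _ hv b.1 b.2, by omega⟩

end TwoNW

namespace TwoNWA

open Matching

variable {α Q P : Type}

section RunAt

variable {B : TwoNWA α Q P} {ω : TwoNW α} {ℓ : ℕ → Q} {h₁ h₂ : ℕ → P} {i j k : ℕ} {a : α}

theorem runAt_cc (ha : ω.word[i - 1]? = some a) (hc₁ : ω.M1.IsCall i) (hc₂ : ω.M2.IsCall i) :
    B.RunAt ω ℓ h₁ h₂ i ↔ ((ℓ (i - 1), a), (h₁ i, h₂ i, ℓ i)) ∈ B.Δcc := by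
  have n1 : ∀ j, ¬ ω.M1.rel j i := fun j h => not_isRet_of_isCall hc₁ ⟨j, h⟩
  have n2 : ∀ j, ¬ ω.M2.rel j i := fun j h => not_isRet_of_isCall hc₂ ⟨j, h⟩
  simp [RunAt, ha, hc₁, hc₂, n1, n2, not_isInt_of_isCall hc₁, not_isInt_of_isCall hc₂]

theorem runAt_rc (ha : ω.word[i - 1]? = some a) (hr : ω.M1.rel j i) (hc : ω.M2.IsCall i) :
    B.RunAt ω ℓ h₁ h₂ i ↔ ((ℓ (i - 1), h₁ j, a), (h₂ i, ℓ i)) ∈ B.Δrc := by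
  have n1 : ¬ ω.M1.IsCall i := fun h => not_isRet_of_isCall h ⟨j, hr⟩
  have n2 : ∀ j, ¬ ω.M2.rel j i := fun j h => not_isRet_of_isCall hc ⟨j, h⟩
  have u : ∀ k, ω.M1.rel k i ↔ k = j := fun k => ⟨eq_of_rel_right hr, fun e => e ▸ hr⟩
  simp [RunAt, ha, hc, n1, n2, u, not_isInt_of_isCall hc, not_isInt_of_isRet ⟨j, hr⟩]

theorem runAt_cr (ha : ω.word[i - 1]? = some a) (hc : ω.M1.IsCall i) (hr : ω.M2.rel j i) :
    B.RunAt ω ℓ h₁ h₂ i ↔ ((ℓ (i - 1), h₂ j, a), (h₁ i, ℓ i)) ∈ B.Δcr := by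
  have n1 : ¬ ω.M2.IsCall i := fun h => not_isRet_of_isCall h ⟨j, hr⟩
  have n2 : ∀ j, ¬ ω.M1.rel j i := fun j h => not_isRet_of_isCall hc ⟨j, h⟩
  have u : ∀ k, ω.M2.rel k i ↔ k = j := fun k => ⟨eq_of_rel_right hr, fun e => e ▸ hr⟩
  simp [RunAt, ha, hc, n1, n2, u, not_isInt_of_isCall hc, not_isInt_of_isRet ⟨j, hr⟩]

theorem runAt_rr (ha : ω.word[i - 1]? = some a) (hr₁ : ω.M1.rel j i) (hr₂ : ω.M2.rel k i) :
    B.RunAt ω ℓ h₁ h₂ i ↔ ((ℓ (i - 1), h₁ j, h₂ k, a), ℓ i) ∈ B.Δrr := by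
  have n1 : ¬ ω.M1.IsCall i := fun h => not_isRet_of_isCall h ⟨j, hr₁⟩
  have n2 : ¬ ω.M2.IsCall i := fun h => not_isRet_of_isCall h ⟨k, hr₂⟩
  have u1 : ∀ l, ω.M1.rel l i ↔ l = j := fun l => ⟨eq_of_rel_right hr₁, fun e => e ▸ hr₁⟩
  have u2 : ∀ l, ω.M2.rel l i ↔ l = k := fun l => ⟨eq_of_rel_right hr₂, fun e => e ▸ hr₂⟩
  simp [RunAt, ha, n1, n2, u1, u2, not_isInt_of_isRet ⟨j, hr₁⟩, not_isInt_of_isRet ⟨k, hr₂⟩]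

theorem runAt_ii (ha : ω.word[i - 1]? = some a) (h₁' : ω.M1.IsInt i) (h₂' : ω.M2.IsInt i) :
    B.RunAt ω ℓ h₁ h₂ i ↔ ((ℓ (i - 1), a), ℓ i) ∈ B.Δii := by
  have n1 : ∀ j, ¬ ω.M1.rel j i := fun j h => h₁'.2 ⟨j, h⟩
  have n2 : ∀ j, ¬ ω.M2.rel j i := fun j h => h₂'.2 ⟨j, h⟩
  simp [RunAt, ha, h₁'.1, h₂'.1, n1, n2, h₁', h₂']

theorem RunAt.congr {ℓ' : ℕ → Q} {h₁' h₂' : ℕ → P} (h : B.RunAt ω ℓ h₁ h₂ i)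
    (e₀ : ℓ (i - 1) = ℓ' (i - 1)) (e : ℓ i = ℓ' i)
    (c₁ : ω.M1.IsCall i → h₁ i = h₁' i) (c₂ : ω.M2.IsCall i → h₂ i = h₂' i)
    (r₁ : ∀ j, ω.M1.rel j i → h₁ j = h₁' j) (r₂ : ∀ j, ω.M2.rel j i → h₂ j = h₂' j) :
    B.RunAt ω ℓ' h₁' h₂' i := by
  obtain ⟨a, ha, h⟩ := h
  refine ⟨a, ha, ?_⟩
  rw [← e₀, ← e]
  rcases h with ⟨x, y, h⟩ | ⟨j, x, y, h⟩ | ⟨x, j, y, h⟩ | ⟨j, k, x, y, h⟩ | ⟨x, y, h⟩ |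
    ⟨x, y, h⟩ | ⟨j, x, y, h⟩ | ⟨x, j, y, h⟩ | ⟨x, y, h⟩
  · exact .inl ⟨x, y, by rwa [← c₁ x, ← c₂ y]⟩
  · exact .inr <| .inl ⟨j, x, y, by rwa [← r₁ j x, ← c₂ y]⟩
  · exact .inr <| .inr <| .inl ⟨x, j, y, by rwa [← c₁ x, ← r₂ j y]⟩
  · exact .inr <| .inr <| .inr <| .inl ⟨j, k, x, y, by rwa [← r₁ j x, ← r₂ k y]⟩
  · exact .inr <| .inr <| .inr <| .inr <| .inl ⟨x, y, by rwa [← c₁ x]⟩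
  · exact .inr <| .inr <| .inr <| .inr <| .inr <| .inl ⟨x, y, by rwa [← c₂ y]⟩
  · exact .inr <| .inr <| .inr <| .inr <| .inr <| .inr <| .inl ⟨j, x, y, by rwa [← r₁ j x]⟩
  · exact .inr <| .inr <| .inr <| .inr <| .inr <| .inr <| .inr <| .inl
      ⟨x, j, y, by rwa [← r₂ j y]⟩
  · exact .inr <| .inr <| .inr <| .inr <| .inr <| .inr <| .inr <| .inr ⟨x, y, h⟩

end RunAt

section PostForm

variable {A : TwoNWA α Q Q} {ω : TwoNW α} {ℓ : ℕ → Q} {h₁ h₂ : ℕ → Q} {i : ℕ}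

theorem PostForm.eq_of_runAt (hA : A.PostForm) (h : A.RunAt ω ℓ h₁ h₂ i) :
    (ω.M1.IsCall i → h₁ i = ℓ i) ∧ (ω.M2.IsCall i → h₂ i = ℓ i) := by
  obtain ⟨pcc, prc, pcr, pci, pic⟩ := hA
  obtain ⟨a, ha, h⟩ := h
  rcases h with ⟨x, y, h⟩ | ⟨j, x, y, h⟩ | ⟨x, j, y, h⟩ | ⟨j, k, x, y, h⟩ | ⟨x, y, h⟩ |
    ⟨x, y, h⟩ | ⟨j, x, y, h⟩ | ⟨x, j, y, h⟩ | ⟨x, y, h⟩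
  · exact ⟨fun _ => (pcc _ h).1, fun _ => (pcc _ h).2⟩
  · exact ⟨fun c => absurd ⟨j, x⟩ (not_isRet_of_isCall c), fun _ => prc _ h⟩
  · exact ⟨fun _ => pcr _ h, fun c => absurd ⟨j, y⟩ (not_isRet_of_isCall c)⟩
  · exact ⟨fun c => absurd ⟨j, x⟩ (not_isRet_of_isCall c),
      fun c => absurd ⟨k, y⟩ (not_isRet_of_isCall c)⟩
  · exact ⟨fun _ => pci _ h, fun c => absurd c y.1⟩
  · exact ⟨fun c => absurd c x.1, fun _ => pic _ h⟩
  · exact ⟨fun c => absurd ⟨j, x⟩ (not_isRet_of_isCall c), fun c => absurd c y.1⟩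
  · exact ⟨fun c => absurd c x.1, fun c => absurd ⟨j, y⟩ (not_isRet_of_isCall c)⟩
  · exact ⟨fun c => absurd c x.1, fun c => absurd c y.1⟩

/-- `ℓ` respects the transitions of the post-form automaton `A` at all positions of `J`. -/
def RunOn (A : TwoNWA α Q Q) (ω : TwoNW α) (ℓ : ℕ → Q) (J : Set ℕ) : Prop :=
  ∀ i ∈ J, A.RunAt ω ℓ ℓ ℓ i

theorem PostForm.exec_iff (hA : A.PostForm) {q q' : Q} :
    A.Exec ω q q' ↔ ∃ ℓ, ℓ 0 = q ∧ A.RunOn ω ℓ (Set.Ioc 0 ω.word.length) ∧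
      ℓ ω.word.length = q' := by
  constructor
  · rintro ⟨ℓ, h₁, h₂, hr, e, e'⟩
    refine ⟨ℓ, e, fun i hi => ?_, e'⟩
    have hri := hr i hi.1 hi.2
    refine hri.congr rfl rfl (hA.eq_of_runAt hri).1 (hA.eq_of_runAt hri).2 (fun j hj => ?_)
      (fun j hj => ?_)
    · have := ω.M1.ordered _ _ hj
      exact (hA.eq_of_runAt (hr j (by omega) (by omega))).1 ⟨i, hj⟩
    · have := ω.M2.ordered _ _ hj
      exact (hA.eq_of_runAt (hr j (by omega) (by omega))).2 ⟨i, hj⟩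
  · rintro ⟨ℓ, e, hr, e'⟩
    exact ⟨ℓ, ℓ, ℓ, fun i h h' => hr i ⟨h, h'⟩, e, e'⟩

theorem RunOn.mono {I J : Set ℕ} (h : A.RunOn ω ℓ J) (hIJ : I ⊆ J) : A.RunOn ω ℓ I :=
  fun i hi => h i (hIJ hi)

theorem RunOn.congr {J : Set ℕ} {ℓ' : ℕ → Q} (h : A.RunOn ω ℓ J) (hJ : ω.WpaSet J)
    (e : ∀ i ∈ J, ℓ (i - 1) = ℓ' (i - 1) ∧ ℓ i = ℓ' i) : A.RunOn ω ℓ' J := fun i hi =>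
  (h i hi).congr (e i hi).1 (e i hi).2 (fun _ => (e i hi).2) (fun _ => (e i hi).2)
    (fun j hj => (e j ((hJ.1 i hi j).2 hj)).2) (fun j hj => (e j ((hJ.2 i hi j).2 hj)).2)

end PostForm

/-- The four transitions of `A` taken along a 2-wave with letters `a, b, c, d`; odd arguments are
the linear states before, even arguments those after the four positions. -/
def WaveStep (A : TwoNWA α Q Q) (a b c d : α) (x q₁ u q₂ m q₃ t q₄ : Q) : Prop :=
  ((x, a), (q₁, q₁, q₁)) ∈ A.Δcc ∧ ((u, q₁, b), (q₂, q₂)) ∈ A.Δrc ∧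
    ((m, q₂, c), (q₃, q₃)) ∈ A.Δcr ∧ ((t, q₃, q₁, d), q₄) ∈ A.Δrr

section Wave

variable {A : TwoNWA α Q Q} {ω : TwoNW α} {i₁ i₂ i₃ i₄ : ℕ} {a b c d : α}

theorem waveStep_iff (hW : IsTwoWaveQuad ω.M1 ω.M2 i₁ i₂ i₃ i₄)
    (ha : ω.word[i₁ - 1]? = some a) (hb : ω.word[i₂ - 1]? = some b)
    (hc : ω.word[i₃ - 1]? = some c) (hd : ω.word[i₄ - 1]? = some d) (ℓ : ℕ → Q) :
    A.RunOn ω ℓ {i₁, i₂, i₃, i₄} ↔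
      A.WaveStep a b c d (ℓ (i₁ - 1)) (ℓ i₁) (ℓ (i₂ - 1)) (ℓ i₂) (ℓ (i₃ - 1)) (ℓ i₃)
        (ℓ (i₄ - 1)) (ℓ i₄) := by
  obtain ⟨-, -, -, h1, h2, h3, h4⟩ := hW
  simp only [RunOn, Set.mem_insert_iff, Set.mem_singleton_iff, forall_eq_or_imp, forall_eq,
    WaveStep, runAt_cc ha ⟨_, h1⟩ ⟨_, h4⟩, runAt_rc hb h1 ⟨_, h3⟩, runAt_cr hc ⟨_, h2⟩ h3,
    runAt_rr hd h2 h4]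

/-- Runs before, in the middle of, and inside a 2-wave can be glued along transitions of the
2-wave. -/
theorem exists_glued_run (hW : IsTwoWaveQuad ω.M1 ω.M2 i₁ i₂ i₃ i₄)
    (ha : ω.word[i₁ - 1]? = some a) (hb : ω.word[i₂ - 1]? = some b)
    (hc : ω.word[i₃ - 1]? = some c) (hd : ω.word[i₄ - 1]? = some d)
    {J : Set ℕ} (hX : ω.WpaSet (J ∩ Set.Iio i₁)) (hM : ω.WpaSet (J ∩ Set.Ioo i₂ i₃))
    (hmax : ∀ j ∈ J, j ≤ i₄) {ℓX ℓM ℓI : ℕ → Q} {q₄ : Q}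
    (rX : A.RunOn ω ℓX (J ∩ Set.Iio i₁)) (rM : A.RunOn ω ℓM (J ∩ Set.Ioo i₂ i₃))
    (rI : A.RunOn ω ℓI (Set.Ioo i₁ i₂ ∪ Set.Ioo i₃ i₄))
    (hs : A.WaveStep a b c d (ℓX (i₁ - 1)) (ℓI i₁) (ℓI (i₂ - 1)) (ℓM i₂) (ℓM (i₃ - 1)) (ℓI i₃)
      (ℓI (i₄ - 1)) q₄) :
    ∃ ℓ, A.RunOn ω ℓ J ∧ (∀ k < i₁, ℓ k = ℓX k) ∧ (∀ k, i₂ ≤ k → k < i₃ → ℓ k = ℓM k) ∧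
      ℓ i₄ = q₄ := by
  obtain ⟨h12, h23, h34, h1, h2, h3, h4⟩ := id hW
  have hpos := ω.M1.ordered _ _ h1
  let ℓ : ℕ → Q := fun k => if k < i₁ then ℓX k else if k < i₂ then ℓI k else
    if k < i₃ then ℓM k else if k < i₄ then ℓI k else q₄
  have eX : ∀ k < i₁, ℓ k = ℓX k := fun k hk => by simp [ℓ, hk]
  have eM : ∀ k, i₂ ≤ k → k < i₃ → ℓ k = ℓM k := fun k hk hk' => by
    simp [ℓ, hk', show ¬ k < i₁ by omega, show ¬ k < i₂ by omega]
  have eI : ∀ k, i₁ ≤ k → k < i₂ → ℓ k = ℓI k := fun k hk hk' => by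
    simp [ℓ, hk', show ¬ k < i₁ by omega]
  have eI' : ∀ k, i₃ ≤ k → k < i₄ → ℓ k = ℓI k := fun k hk hk' => by
    simp [ℓ, hk', show ¬ k < i₁ by omega, show ¬ k < i₂ by omega, show ¬ k < i₃ by omega]
  have e4 : ℓ i₄ = q₄ := by
    simp [ℓ, show ¬ i₄ < i₁ by omega, show ¬ i₄ < i₂ by omega, show ¬ i₄ < i₃ by omega]
  refine ⟨ℓ, ?_, eX, eM, e4⟩
  have rX' := rX.congr (ℓ' := ℓ) hX fun i hi => by
    have : i < i₁ := hi.2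
    exact ⟨(eX _ (by omega)).symm, (eX _ this).symm⟩
  have rM' := rM.congr (ℓ' := ℓ) hM fun i ⟨_, hi, hi'⟩ =>
    ⟨(eM _ (by omega) (by omega)).symm, (eM _ (by omega) hi').symm⟩
  have rI' := rI.congr (ℓ' := ℓ) ⟨(wpa_Ioo h1).union (wpa_Ioo h2), hW.wpa_inner⟩ fun i hi => by
    rcases hi with ⟨hi, hi'⟩ | ⟨hi, hi'⟩
    · exact ⟨(eI _ (by omega) (by omega)).symm, (eI _ (by omega) hi').symm⟩
    · exact ⟨(eI' _ (by omega) (by omega)).symm, (eI' _ (by omega) hi').symm⟩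
  have rW := (waveStep_iff (A := A) hW ha hb hc hd ℓ).2 (by
    rwa [eX _ (by omega), eI _ le_rfl h12, eI (i₂ - 1) (by omega) (by omega), eM _ le_rfl h23,
      eM (i₃ - 1) (by omega) (by omega), eI' _ le_rfl h34, eI' (i₄ - 1) (by omega) (by omega), e4])
  intro i hi
  have := hmax i hi
  by_cases c1 : i < i₁
  · exact rX' i ⟨hi, c1⟩
  by_cases c2 : i₂ < i ∧ i < i₃
  · exact rM' i ⟨hi, c2⟩
  by_cases c3 : i₁ < i ∧ i < i₂ ∨ i₃ < i ∧ i < i₄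
  · exact rI' i c3
  · refine rW i ?_
    simp only [Set.mem_insert_iff, Set.mem_singleton_iff]
    omega

end Wave

end TwoNWA

namespace TwoNWA

open Matching

variable {α Q : Type}

/-- The linear states of the determinized automaton. A triple `(inl p, p, q)` records runs from `p`
to `q`; a triple `(inr (p, p', s), p, q)` records pairs of runs, from `p` to `p'` and from `s` to
`q`, on two intervals connected by `M2`-arches. -/
abbrev RefSet (Q : Type) : Type := Set ((Q ⊕ (Q × Q × Q)) × Q × Q)

namespace RefSet

/-- Start recording runs on a new interval. -/
def fresh : RefSet Q := {y | ∃ q, y = (.inl q, q, q)}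

/-- Start recording runs on a second interval, given the runs on the first one. -/
def pair (S : RefSet Q) : RefSet Q :=
  {y | ∃ p p' s, y = (.inr (p, p', s), p, s) ∧ (.inl p, p, p') ∈ S}

/-- Read an internal letter. -/
def internal (A : TwoNWA α Q Q) (S : RefSet Q) (a : α) : RefSet Q :=
  {y | ∃ q, (y.1, y.2.1, q) ∈ S ∧ ((q, a), y.2.2) ∈ A.Δii}

/-- Complete a 2-wave with letters `a, b, c, d`, where `S₁`, `S₃`, `S₄` are the states before its
first, third and fourth position. -/
def close (A : TwoNWA α Q Q) (S₁ S₃ S₄ : RefSet Q) (a b c d : α) : RefSet Q :=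
  {y | ∃ x q₁ u q₂ m q₃ t, A.WaveStep a b c d x q₁ u q₂ m q₃ t y.2.2 ∧
    (.inr (q₁, u, q₃), q₁, t) ∈ S₄ ∧
    ((y.1, y.2.1, x) ∈ S₁ ∧ (.inl q₂, q₂, m) ∈ S₃ ∨
      ∃ p' s, y.1 = .inr (y.2.1, p', s) ∧ (.inl y.2.1, y.2.1, x) ∈ S₁ ∧
        (.inr (q₂, p', s), q₂, m) ∈ S₃)}

end RefSet

/-- The determinization of a post-form automaton. A hierarchical state stores the linear state
before a call together with the letters read at the call and at its `M2`-partner. -/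
def determinize (A : TwoNWA α Q Q) : TwoNWA α (RefSet Q) (RefSet Q × α × α) where
  init := {S | S = {x | ∃ q₀ ∈ A.init, x = (.inl q₀, q₀, q₀)}}
  final := {S | ∃ q₀ ∈ A.init, ∃ q ∈ A.final, (.inl q₀, q₀, q) ∈ S}
  Δcc := {t | t.2 = ((t.1.1, t.1.2, t.1.2), (t.1.1, t.1.2, t.1.2), .fresh)}
  Δrc := {t | t.2 = ((t.1.1, t.1.2.2, t.1.2.2), .fresh)}
  Δcr := {t | t.2 = ((t.1.1, t.1.2.1.2.1, t.1.2.2), .pair t.1.2.1.1)}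
  Δrr := {t | t.2 = .close A t.1.2.2.1.1 t.1.2.1.1 t.1.1 t.1.2.2.1.2.1 t.1.2.1.2.1 t.1.2.1.2.2
    t.1.2.2.2}
  Δci := {t | t.2 = ((t.1.1, t.1.2, t.1.2), t.1.1)}
  Δic := {t | t.2 = ((t.1.1, t.1.2, t.1.2), t.1.1)}
  Δri := {t | t.2 = t.1.1}
  Δir := {t | t.2 = t.1.1}
  Δii := {t | t.2 = .internal A t.1.1 t.1.2}

theorem determinize_deterministic (A : TwoNWA α Q Q) : A.determinize.Deterministic :=
  ⟨⟨_, rfl⟩, fun _ _ _ h h' => h.trans h'.symm, fun _ _ _ h h' => h.trans h'.symm,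
    fun _ _ _ h h' => h.trans h'.symm, fun _ _ _ h h' => h.trans h'.symm,
    fun _ _ _ h h' => h.trans h'.symm, fun _ _ _ h h' => h.trans h'.symm,
    fun _ _ _ h h' => h.trans h'.symm, fun _ _ _ h h' => h.trans h'.symm,
    fun _ _ _ h h' => h.trans h'.symm⟩

theorem determinize_complete (A : TwoNWA α Q Q) : A.determinize.Complete := by
  simp [Complete, determinize]

/-- The sequence `D` of linear states evolves on `ω` as in a run of `A.determinize`. -/
structure Tracks (A : TwoNWA α Q Q) (ω : TwoNW α) (D : ℕ → RefSet Q) : Prop where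
  internal : ∀ i a, ω.word[i - 1]? = some a → 1 ≤ i → ω.M1.IsInt i → ω.M2.IsInt i →
    D i = .internal A (D (i - 1)) a
  wave : ∀ i₁ i₂ i₃ i₄ a b c d, IsTwoWaveQuad ω.M1 ω.M2 i₁ i₂ i₃ i₄ →
    ω.word[i₁ - 1]? = some a → ω.word[i₂ - 1]? = some b → ω.word[i₃ - 1]? = some c →
    ω.word[i₄ - 1]? = some d →
    D i₁ = .fresh ∧ D i₂ = .fresh ∧ D i₃ = .pair (D (i₂ - 1)) ∧
      D i₄ = .close A (D (i₁ - 1)) (D (i₃ - 1)) (D (i₄ - 1)) a b c d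

theorem IsRun.tracks {A : TwoNWA α Q Q} {ω : TwoNW α} {D : ℕ → RefSet Q}
    {h₁ h₂ : ℕ → RefSet Q × α × α} (hr : A.determinize.IsRun ω D h₁ h₂) : A.Tracks ω D := by
  constructor
  · intro i a ha hi hi1 hi2
    have hlen : i - 1 < ω.word.length := (List.getElem?_eq_some_iff.1 ha).1
    exact (runAt_ii ha hi1 hi2).1 (hr i hi (by omega))
  · intro i₁ i₂ i₃ i₄ a b c d hW ha hb hc hd
    obtain ⟨h12, h23, h34, e1, e2, e3, e4⟩ := hW
    have o1 := ω.M1.ordered _ _ e1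
    have o2 := ω.M1.ordered _ _ e2
    have t1 := (runAt_cc ha ⟨_, e1⟩ ⟨_, e4⟩).1 (hr i₁ (by omega) (by omega))
    have t2 := (runAt_rc hb e1 ⟨_, e3⟩).1 (hr i₂ (by omega) (by omega))
    have t3 := (runAt_cr hc ⟨_, e2⟩ e3).1 (hr i₃ (by omega) (by omega))
    have t4 := (runAt_rr hd e2 e4).1 (hr i₄ (by omega) (by omega))
    simp only [determinize, Set.mem_ofPred_eq, Prod.mk.injEq] at t1 t2 t3 t4
    obtain ⟨-, t1, t1'⟩ := t1
    obtain ⟨t2, t2'⟩ := t2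
    obtain ⟨t3, t3'⟩ := t3
    rw [t2] at t3 t3'
    rw [t3, t1] at t4
    exact ⟨t1', t2', t3', t4⟩

section Correctness

variable {A : TwoNWA α Q Q} {ω : TwoNW α} {D : ℕ → RefSet Q}

theorem exists_letter {i : ℕ} (h : 1 ≤ i) (h' : i ≤ ω.word.length) :
    ∃ a, ω.word[i - 1]? = some a :=
  ⟨_, List.getElem?_eq_getElem (by omega)⟩

theorem exists_letters {i₁ i₂ i₃ i₄ : ℕ} (hW : IsTwoWaveQuad ω.M1 ω.M2 i₁ i₂ i₃ i₄) :
    ∃ a b c d, ω.word[i₁ - 1]? = some a ∧ ω.word[i₂ - 1]? = some b ∧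
      ω.word[i₃ - 1]? = some c ∧ ω.word[i₄ - 1]? = some d := by
  have o1 := ω.M1.ordered _ _ hW.2.2.2.1
  have o2 := ω.M1.ordered _ _ hW.2.2.2.2.1
  obtain ⟨a, ha⟩ := exists_letter (ω := ω) (i := i₁) (by omega) (by omega)
  obtain ⟨b, hb⟩ := exists_letter (ω := ω) (i := i₂) (by omega) (by omega)
  obtain ⟨c, hc⟩ := exists_letter (ω := ω) (i := i₃) (by omega) (by omega)
  obtain ⟨d, hd⟩ := exists_letter (ω := ω) (i := i₄) (by omega) (by omega)
  exact ⟨a, b, c, d, ha, hb, hc, hd⟩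

/-- `D d` describes the runs on `J` constrained by `Φ`, classified by their reference states and
their state at position `d`. -/
def Captures (A : TwoNWA α Q Q) (ω : TwoNW α) (D : ℕ → RefSet Q) (J : Set ℕ) (d : ℕ)
    (Φ : Q ⊕ (Q × Q × Q) → Q → (ℕ → Q) → Prop) : Prop :=
  ∀ r₁ r₂ q, (r₁, r₂, q) ∈ D d ↔ ∃ ℓ, Φ r₁ r₂ ℓ ∧ A.RunOn ω ℓ J ∧ ℓ d = q

theorem Captures.internal (hD : A.Tracks ω D) {J : Set ℕ} (hJ : ω.WpaSet J) {d : ℕ}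
    (hdJ : d ∈ J) (hmax : ∀ j ∈ J, j ≤ d) (hd : 1 ≤ d) (hdn : d ≤ ω.word.length)
    (hi₁ : ω.M1.IsInt d) (hi₂ : ω.M2.IsInt d) {Φ : Q ⊕ (Q × Q × Q) → Q → (ℕ → Q) → Prop}
    (hΦ : ∀ r₁ r₂ ℓ ℓ', (∀ k < d, ℓ k = ℓ' k) → Φ r₁ r₂ ℓ → Φ r₁ r₂ ℓ')
    (ih : A.Captures ω D (J ∩ Set.Iio d) (d - 1) Φ) : A.Captures ω D J d Φ := by
  obtain ⟨a, ha⟩ := exists_letter hd hdn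
  intro r₁ r₂ q'
  rw [hD.internal d a ha hd hi₁ hi₂]
  constructor
  · rintro ⟨q, hq, hqq'⟩
    obtain ⟨ℓ, hℓ, hr, rfl⟩ := (ih _ _ _).1 hq
    have e : ∀ k < d, ℓ k = Function.update ℓ d q' k := fun k hk => by
      rw [Function.update_of_ne hk.ne]
    refine ⟨Function.update ℓ d q', hΦ _ _ _ _ e hℓ, fun i hi => ?_, by simp⟩
    rcases (hmax i hi).lt_or_eq with hlt | rfl
    · refine hr.congr ⟨hJ.1.inter_Iio_of_isInt hi₁ hmax, hJ.2.inter_Iio_of_isInt hi₂ hmax⟩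
        (fun i hi => ?_) i ⟨hi, hlt⟩
      have : i < d := hi.2
      exact ⟨e _ (by omega), e _ this⟩
    · rw [runAt_ii ha hi₁ hi₂, ← e _ (by omega)]
      simpa using hqq'
  · rintro ⟨ℓ, hℓ, hr, rfl⟩
    exact ⟨ℓ (d - 1), (ih _ _ _).2 ⟨ℓ, hℓ, hr.mono Set.inter_subset_left, rfl⟩,
      (runAt_ii ha hi₁ hi₂).1 (hr d hdJ)⟩

/-- Constraint on runs over one interval whose first linear state is at position `a`. -/
def FromState (D : ℕ → RefSet Q) (a : ℕ) (r₁ : Q ⊕ (Q × Q × Q)) (r₂ : Q) (ℓ : ℕ → Q) : Prop :=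
  (r₁, r₂, ℓ a) ∈ D a

/-- Constraint on runs over two intervals `(a, b]` and `(c, _]`. -/
def FromPair (a b c : ℕ) (r₁ : Q ⊕ (Q × Q × Q)) (r₂ : Q) (ℓ : ℕ → Q) : Prop :=
  r₁ = .inr (ℓ a, ℓ b, ℓ c) ∧ r₂ = ℓ a

section Wave

variable {i₁ i₂ i₃ i₄ : ℕ} {J : Set ℕ}

/-- A 2-wave all of whose positions belong to one interval. -/
theorem Captures.wave (hω : ω.IsWaveWord) (hD : A.Tracks ω D) (hJ : ω.WpaSet J)
    (hW : IsTwoWaveQuad ω.M1 ω.M2 i₁ i₂ i₃ i₄) (hmax : ∀ j ∈ J, j ≤ i₄)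
    (hWJ : {i₁, i₂, i₃, i₄} ⊆ J) (hIJ : Set.Ioo i₁ i₂ ∪ Set.Ioo i₃ i₄ ⊆ J)
    {Φ : Q ⊕ (Q × Q × Q) → Q → (ℕ → Q) → Prop}
    (hΦ : ∀ r₁ r₂ ℓ ℓ', (∀ k < i₁, ℓ k = ℓ' k) → Φ r₁ r₂ ℓ → Φ r₁ r₂ ℓ')
    (ihX : A.Captures ω D (J ∩ Set.Iio i₁) (i₁ - 1) Φ)
    (ihI : A.Captures ω D (Set.Ioo i₁ i₂ ∪ Set.Ioo i₃ i₄) (i₄ - 1) (FromPair i₁ (i₂ - 1) i₃))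
    (ihM : A.Captures ω D (J ∩ Set.Ioo i₂ i₃) (i₃ - 1) (FromState D i₂)) :
    A.Captures ω D J i₄ Φ := by
  obtain ⟨a, b, c, d, ha, hb, hc, hd⟩ := exists_letters hW
  obtain ⟨-, D2, -, D4⟩ := hD.wave _ _ _ _ _ _ _ _ hW ha hb hc hd
  intro r₁ r₂ q'
  rw [D4]
  constructor
  · rintro ⟨x, q₁, u, q₂, m, q₃, t, hs, hI, ⟨hX, hM⟩ | ⟨p', s, -, -, hM⟩⟩
    · obtain ⟨ℓX, hΦX, rX, rfl⟩ := (ihX _ _ _).1 hX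
      obtain ⟨ℓI, ⟨e1, e2⟩, rI, rfl⟩ := (ihI _ _ _).1 hI
      obtain ⟨ℓM, hΦM, rM, rfl⟩ := (ihM _ _ _).1 hM
      simp only [FromState, D2, RefSet.fresh, Set.mem_ofPred_eq, Prod.mk.injEq] at hΦM
      obtain ⟨q, -, rfl, rfl⟩ := hΦM
      simp only [Sum.inr.injEq, Prod.mk.injEq] at e1
      obtain ⟨rfl, rfl, rfl⟩ := e1
      obtain ⟨ℓ, hr, eX, -, e4⟩ := exists_glued_run hW ha hb hc hd
        (hω.wpa_before hJ hW hmax) (hω.wpa_middle hJ hW hmax) hmax rX rM rI hs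
      exact ⟨ℓ, hΦ _ _ _ _ (fun k hk => (eX k hk).symm) hΦX, hr, e4⟩
    · obtain ⟨ℓM, hΦM, -⟩ := (ihM _ _ _).1 hM
      simp [FromState, D2, RefSet.fresh] at hΦM
  · rintro ⟨ℓ, hℓ, hr, rfl⟩
    exact ⟨_, _, _, _, _, _, _, (waveStep_iff hW ha hb hc hd ℓ).1 (hr.mono hWJ),
      (ihI _ _ _).2 ⟨ℓ, ⟨rfl, rfl⟩, hr.mono hIJ, rfl⟩,
      .inl ⟨(ihX _ _ _).2 ⟨ℓ, hℓ, hr.mono Set.inter_subset_left, rfl⟩,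
        (ihM _ _ _).2 ⟨ℓ, by rw [FromState, D2]; exact ⟨_, rfl⟩,
          hr.mono Set.inter_subset_left, rfl⟩⟩⟩

/-- A 2-wave whose first `M1`-arch lies in a first interval `(p, b]` and whose second `M1`-arch lies
in a second interval starting after `c`. -/
theorem Captures.nested_wave (hω : ω.IsWaveWord) (hD : A.Tracks ω D) (hJ : ω.WpaSet J)
    (hW : IsTwoWaveQuad ω.M1 ω.M2 i₁ i₂ i₃ i₄) (hmax : ∀ j ∈ J, j ≤ i₄)
    (hWJ : {i₁, i₂, i₃, i₄} ⊆ J) (hIJ : Set.Ioo i₁ i₂ ∪ Set.Ioo i₃ i₄ ⊆ J) {p b c : ℕ}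
    (hp : p < i₁) (hb : i₂ ≤ b) (hbc : b < c) (hc : c < i₃) (hDp : D p = .fresh)
    (ihX : A.Captures ω D (J ∩ Set.Iio i₁) (i₁ - 1) (FromState D p))
    (ihI : A.Captures ω D (Set.Ioo i₁ i₂ ∪ Set.Ioo i₃ i₄) (i₄ - 1) (FromPair i₁ (i₂ - 1) i₃))
    (ihM : A.Captures ω D (J ∩ Set.Ioo i₂ i₃) (i₃ - 1) (FromPair i₂ b c)) :
    A.Captures ω D J i₄ (FromPair p b c) := by
  obtain ⟨a₁, a₂, a₃, a₄, ha₁, ha₂, ha₃, ha₄⟩ := exists_letters hW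
  obtain ⟨-, -, -, D4⟩ := hD.wave _ _ _ _ _ _ _ _ hW ha₁ ha₂ ha₃ ha₄
  intro r₁ r₂ q'
  rw [D4]
  constructor
  · rintro ⟨x, q₁, u, q₂, m, q₃, t, hs, hI, ⟨-, hM⟩ | ⟨p', s, hr₁, hX, hM⟩⟩
    · obtain ⟨ℓM, ⟨hΦM, -⟩, -⟩ := (ihM _ _ _).1 hM
      simp at hΦM
    · obtain ⟨ℓX, hΦX, rX, rfl⟩ := (ihX _ _ _).1 hX
      obtain ⟨ℓI, ⟨e1, e2⟩, rI, rfl⟩ := (ihI _ _ _).1 hI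
      obtain ⟨ℓM, ⟨e3, -⟩, rM, rfl⟩ := (ihM _ _ _).1 hM
      simp only [FromState, hDp, RefSet.fresh, Set.mem_ofPred_eq, Prod.mk.injEq] at hΦX
      obtain ⟨q, -, hq, hq'⟩ := hΦX
      simp only [Sum.inr.injEq, Prod.mk.injEq] at e1 e3
      obtain ⟨rfl, rfl, rfl⟩ := e1
      obtain ⟨rfl, rfl, rfl⟩ := e3
      obtain ⟨ℓ, hr, eX, eM, e4⟩ := exists_glued_run hW ha₁ ha₂ ha₃ ha₄
        (hω.wpa_before hJ hW hmax) (hω.wpa_middle hJ hW hmax) hmax rX rM rI hs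
      have hr₂ : r₂ = ℓ p := by rw [eX p hp, hq', ← hq]
      refine ⟨ℓ, ⟨?_, hr₂⟩, hr, e4⟩
      rw [eM b hb (by omega), eM c (by omega) hc, ← hr₂]
      exact hr₁
  · rintro ⟨ℓ, ⟨rfl, rfl⟩, hr, rfl⟩
    exact ⟨_, _, _, _, _, _, _, (waveStep_iff hW ha₁ ha₂ ha₃ ha₄ ℓ).1 (hr.mono hWJ),
      (ihI _ _ _).2 ⟨ℓ, ⟨rfl, rfl⟩, hr.mono hIJ, rfl⟩,
      .inr ⟨_, _, rfl, (ihX _ _ _).2 ⟨ℓ, by rw [FromState, hDp]; exact ⟨_, rfl⟩,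
          hr.mono Set.inter_subset_left, rfl⟩,
        (ihM _ _ _).2 ⟨ℓ, ⟨rfl, rfl⟩, hr.mono Set.inter_subset_left, rfl⟩⟩⟩

end Wave

/-- Starting a second interval after a first one. -/
theorem Captures.pair {a b c : ℕ} (hab : a ≤ b) (hbc : b < c) (hJ : ω.WpaSet (Set.Ioc a b))
    (hDa : D a = .fresh) (hDc : D c = .pair (D b))
    (ih : A.Captures ω D (Set.Ioc a b) b (FromState D a)) :
    A.Captures ω D (Set.Ioc a b) c (FromPair a b c) := by
  intro r₁ r₂ q'
  rw [hDc]
  constructor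
  · rintro ⟨p, p', s, e, hp⟩
    obtain ⟨rfl, rfl, rfl⟩ : r₁ = .inr (p, p', s) ∧ r₂ = p ∧ q' = s := by simpa using e
    obtain ⟨ℓ, hℓ, hr, rfl⟩ := (ih _ _ _).1 hp
    simp only [FromState, hDa, RefSet.fresh, Set.mem_ofPred_eq, Prod.mk.injEq] at hℓ
    obtain ⟨q, -, rfl, hq⟩ := hℓ
    have e : ∀ k ≤ b, ℓ k = Function.update ℓ c q' k := fun k hk => by
      rw [Function.update_of_ne (by omega)]
    refine ⟨Function.update ℓ c q', ⟨?_, ?_⟩,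
      hr.congr hJ fun i hi => ⟨e _ (by have := hi.2; omega), e _ hi.2⟩, by simp⟩
    · rw [← e a hab, ← e b le_rfl, hq, Function.update_self]
    · rw [← e a hab, hq]
  · rintro ⟨ℓ, ⟨rfl, rfl⟩, hr, rfl⟩
    exact ⟨_, _, _, rfl, (ih _ _ _).2 ⟨ℓ, by rw [FromState, hDa]; exact ⟨_, rfl⟩, hr, rfl⟩⟩

theorem FromState.congr {a d : ℕ} (h : a < d) (r₁ : Q ⊕ (Q × Q × Q)) (r₂ : Q) (ℓ ℓ' : ℕ → Q)
    (e : ∀ k < d, ℓ k = ℓ' k) (hℓ : FromState D a r₁ r₂ ℓ) : FromState D a r₁ r₂ ℓ' := by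
  rwa [FromState, ← e a h]

theorem FromPair.congr {a b c d : ℕ} (hab : a ≤ b) (hbc : b < c) (hcd : c < d)
    (r₁ : Q ⊕ (Q × Q × Q)) (r₂ : Q) (ℓ ℓ' : ℕ → Q)
    (e : ∀ k < d, ℓ k = ℓ' k) (hℓ : FromPair a b c r₁ r₂ ℓ) : FromPair a b c r₁ r₂ ℓ' := by
  rwa [FromPair, ← e a (by omega), ← e b (by omega), ← e c hcd]

/-- Simultaneous induction for single intervals and for pairs of intervals. -/
theorem captures_of_size_lt (hω : ω.IsWaveWord) (hD : A.Tracks ω D) (N : ℕ) :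
    (∀ a b, a ≤ b → b ≤ ω.word.length → b - a < N → ω.WpaSet (Set.Ioc a b) →
      A.Captures ω D (Set.Ioc a b) b (FromState D a)) ∧
    (∀ a b c d, a ≤ b → b < c → c ≤ d → d ≤ ω.word.length → (b - a) + (d - c) + 1 < N →
      ω.M1.Wpa (Set.Ioc a b) → ω.M1.Wpa (Set.Ioc c d) →
      ω.M2.Wpa (Set.Ioc a b ∪ Set.Ioc c d) → D a = .fresh → D c = .pair (D b) →
      A.Captures ω D (Set.Ioc a b ∪ Set.Ioc c d) d (FromPair a b c)) := by
  induction N with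
  | zero => exact ⟨fun _ _ _ _ h => absurd h (by omega), fun _ _ _ _ _ _ _ _ h => absurd h (by omega)⟩
  | succ N ih =>
    obtain ⟨ihS, ihP⟩ := ih
    have inner : ∀ {i₁ i₂ i₃ i₄}, IsTwoWaveQuad ω.M1 ω.M2 i₁ i₂ i₃ i₄ →
        (i₂ - 1 - i₁) + (i₄ - 1 - i₃) + 1 < N →
        A.Captures ω D (Set.Ioo i₁ i₂ ∪ Set.Ioo i₃ i₄) (i₄ - 1)
          (FromPair i₁ (i₂ - 1) i₃) := by
      intro i₁ i₂ i₃ i₄ hW hN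
      obtain ⟨h12, h23, h34, h1, h2, h3, h4⟩ := id hW
      obtain ⟨x₁, x₂, x₃, x₄, hx₁, hx₂, hx₃, hx₄⟩ := exists_letters hW
      obtain ⟨D1, -, D3, -⟩ := hD.wave _ _ _ _ _ _ _ _ hW hx₁ hx₂ hx₃ hx₄
      have e : ∀ k l : ℕ, k < l → Set.Ioo k l = Set.Ioc k (l - 1) := by
        intro k l h; ext i; simp only [Set.mem_Ioo, Set.mem_Ioc]; omega
      have w1 := wpa_Ioo h1
      have w2 := wpa_Ioo h2
      have w3 := hW.wpa_inner
      have o := ω.M1.ordered _ _ h2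
      rw [e _ _ h12, e _ _ h34] at w3 ⊢
      rw [e _ _ h12] at w1
      rw [e _ _ h34] at w2
      exact ihP _ _ _ _ (by omega) (by omega) (by omega) (by omega) hN w1 w2 w3 D1 D3
    constructor
    · intro a b hab hbn hN hJ
      rcases hab.eq_or_lt with rfl | hlt
      · intro r₁ r₂ q
        exact ⟨fun h => ⟨fun _ => q, h, fun i hi => by simp at hi, rfl⟩,
          by rintro ⟨ℓ, h, -, rfl⟩; exact h⟩
      have hmax : ∀ j ∈ Set.Ioc a b, j ≤ b := fun j hj => hj.2
      rcases hω.last_position hJ (d := b) ⟨hlt, le_rfl⟩ hmax with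
        ⟨hi₁, hi₂⟩ | ⟨i₁, i₂, i₃, hW, m1, m2, m3⟩
      · have w : ω.WpaSet (Set.Ioc a b ∩ Set.Iio b) :=
          ⟨hJ.1.inter_Iio_of_isInt hi₁ hmax, hJ.2.inter_Iio_of_isInt hi₂ hmax⟩
        refine Captures.internal hD hJ ⟨hlt, le_rfl⟩ hmax (by omega) hbn hi₁ hi₂
          (FromState.congr hlt) ?_
        have e : Set.Ioc a b ∩ Set.Iio b = Set.Ioc a (b - 1) := by
          ext i; simp only [Set.mem_inter_iff, Set.mem_Ioc, Set.mem_Iio]; omega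
        rw [e] at w ⊢
        exact ihS _ _ (by omega) (by omega) (by omega) w
      · obtain ⟨h12, h23, h34, -⟩ := id hW
        have wX := hω.wpa_before hJ hW hmax
        have wM := hω.wpa_middle hJ hW hmax
        have m1' := m1.1
        have eX : Set.Ioc a b ∩ Set.Iio i₁ = Set.Ioc a (i₁ - 1) := by
          ext i; simp only [Set.mem_inter_iff, Set.mem_Ioc, Set.mem_Iio]; omega
        have eM : Set.Ioc a b ∩ Set.Ioo i₂ i₃ = Set.Ioc i₂ (i₃ - 1) := by
          ext i; simp only [Set.mem_inter_iff, Set.mem_Ioc, Set.mem_Ioo]; omega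
        refine Captures.wave hω hD hJ hW hmax ?_ ?_ (FromState.congr m1') ?_
          (inner hW (by omega)) ?_
        · intro i; simp only [Set.mem_insert_iff, Set.mem_singleton_iff, Set.mem_Ioc]; omega
        · intro i; simp only [Set.mem_union, Set.mem_Ioo, Set.mem_Ioc]; omega
        · rw [eX] at wX ⊢
          exact ihS _ _ (by omega) (by omega) (by omega) wX
        · rw [eM] at wM ⊢
          exact ihS _ _ (by omega) (by omega) (by omega) wM
    · intro a b c d hab hbc hcd hdn hN w1 w1' w2 hDa hDc
      have hJ : ω.WpaSet (Set.Ioc a b ∪ Set.Ioc c d) := ⟨w1.union w1', w2⟩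
      rcases hcd.eq_or_lt with rfl | hlt
      · rw [Set.Ioc_self, Set.union_empty] at hJ ⊢
        exact Captures.pair hab hbc hJ hDa hDc
          (ihS _ _ hab (by omega) (by omega) hJ)
      have hmax : ∀ j ∈ Set.Ioc a b ∪ Set.Ioc c d, j ≤ d := by
        intro j; simp only [Set.mem_union, Set.mem_Ioc]; omega
      have hdJ : d ∈ Set.Ioc a b ∪ Set.Ioc c d := .inr ⟨hlt, le_rfl⟩
      rcases hω.last_position hJ hdJ hmax with ⟨hi₁, hi₂⟩ | ⟨i₁, i₂, i₃, hW, m1, m2, m3⟩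
      · have w : ω.M2.Wpa ((Set.Ioc a b ∪ Set.Ioc c d) ∩ Set.Iio d) :=
          w2.inter_Iio_of_isInt hi₂ hmax
        have w' : ω.M1.Wpa (Set.Ioc c d ∩ Set.Iio d) :=
          w1'.inter_Iio_of_isInt hi₁ fun j hj => hj.2
        refine Captures.internal hD hJ hdJ hmax (by omega) hdn hi₁ hi₂
          (FromPair.congr hab hbc hlt) ?_
        have e : (Set.Ioc a b ∪ Set.Ioc c d) ∩ Set.Iio d = Set.Ioc a b ∪ Set.Ioc c (d - 1) := by
          ext i; simp only [Set.mem_inter_iff, Set.mem_union, Set.mem_Ioc, Set.mem_Iio]; omega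
        have e' : Set.Ioc c d ∩ Set.Iio d = Set.Ioc c (d - 1) := by
          ext i; simp only [Set.mem_inter_iff, Set.mem_Ioc, Set.mem_Iio]; omega
        rw [e] at w ⊢
        rw [e'] at w'
        exact ihP _ _ _ _ hab hbc (by omega) (by omega) (by omega) w1 w' w hDa hDc
      · obtain ⟨h12, h23, h34, r1, r2, -⟩ := id hW
        have wX := hω.wpa_before hJ hW hmax
        have wM := hω.wpa_middle hJ hW hmax
        have m3' : i₃ ∈ Set.Ioc c d := (w1' d ⟨hlt, le_rfl⟩ _).2 r2
        have hc3 := m3'.1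
        rcases m1 with m1 | m1
        · have m2' := (w1 _ m1 _).1 r1
          have ha1 := m1.1
          have h2b := m2'.2
          obtain ⟨x₁, x₂, x₃, x₄, hx₁, hx₂, hx₃, hx₄⟩ := exists_letters hW
          obtain ⟨-, D2, -⟩ := hD.wave _ _ _ _ _ _ _ _ hW hx₁ hx₂ hx₃ hx₄
          have eX : (Set.Ioc a b ∪ Set.Ioc c d) ∩ Set.Iio i₁ = Set.Ioc a (i₁ - 1) := by
            ext i; simp only [Set.mem_inter_iff, Set.mem_union, Set.mem_Ioc, Set.mem_Iio]; omega
          have eM : (Set.Ioc a b ∪ Set.Ioc c d) ∩ Set.Ioo i₂ i₃ =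
              Set.Ioc i₂ b ∪ Set.Ioc c (i₃ - 1) := by
            ext i; simp only [Set.mem_inter_iff, Set.mem_union, Set.mem_Ioc, Set.mem_Ioo]; omega
          have eM1 : Set.Ioc a b ∩ ((Set.Ioc a b ∪ Set.Ioc c d) ∩ Set.Ioo i₂ i₃) =
              Set.Ioc i₂ b := by
            ext i; simp only [Set.mem_inter_iff, Set.mem_union, Set.mem_Ioc, Set.mem_Ioo]; omega
          have eM2 : Set.Ioc c d ∩ ((Set.Ioc a b ∪ Set.Ioc c d) ∩ Set.Ioo i₂ i₃) =
              Set.Ioc c (i₃ - 1) := by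
            ext i; simp only [Set.mem_inter_iff, Set.mem_union, Set.mem_Ioc, Set.mem_Ioo]; omega
          have wM1 := w1.inter wM.1
          have wM2 := w1'.inter wM.1
          refine Captures.nested_wave hω hD hJ hW hmax ?_ ?_ ha1 h2b hbc hc3 hDa ?_
            (inner hW (by omega)) ?_
          · intro i
            simp only [Set.mem_insert_iff, Set.mem_singleton_iff, Set.mem_union, Set.mem_Ioc]
            omega
          · intro i; simp only [Set.mem_union, Set.mem_Ioo, Set.mem_Ioc]; omega
          · rw [eX] at wX ⊢
            exact ihS _ _ (by omega) (by omega) (by omega) wX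
          · rw [eM1] at wM1
            rw [eM2] at wM2
            rw [eM] at wM ⊢
            exact ihP _ _ _ _ h2b hbc (by omega) (by omega) (by omega) wM1 wM2 wM.2 D2 hDc
        · have hc1 := m1.1
          have eX : (Set.Ioc a b ∪ Set.Ioc c d) ∩ Set.Iio i₁ =
              Set.Ioc a b ∪ Set.Ioc c (i₁ - 1) := by
            ext i; simp only [Set.mem_inter_iff, Set.mem_union, Set.mem_Ioc, Set.mem_Iio]; omega
          have eX' : Set.Ioc c d ∩ ((Set.Ioc a b ∪ Set.Ioc c d) ∩ Set.Iio i₁) =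
              Set.Ioc c (i₁ - 1) := by
            ext i; simp only [Set.mem_inter_iff, Set.mem_union, Set.mem_Ioc, Set.mem_Iio]; omega
          have eM : (Set.Ioc a b ∪ Set.Ioc c d) ∩ Set.Ioo i₂ i₃ = Set.Ioc i₂ (i₃ - 1) := by
            ext i; simp only [Set.mem_inter_iff, Set.mem_union, Set.mem_Ioc, Set.mem_Ioo]; omega
          have wX' := w1'.inter wX.1
          refine Captures.wave hω hD hJ hW hmax ?_ ?_ (FromPair.congr hab hbc hc1) ?_
            (inner hW (by omega)) ?_
          · intro i
            simp only [Set.mem_insert_iff, Set.mem_singleton_iff, Set.mem_union, Set.mem_Ioc]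
            omega
          · intro i; simp only [Set.mem_union, Set.mem_Ioo, Set.mem_Ioc]; omega
          · rw [eX'] at wX'
            rw [eX] at wX ⊢
            exact ihP _ _ _ _ hab hbc (by omega) (by omega) (by omega) w1 wX' wX.2 hDa hDc
          · rw [eM] at wM ⊢
            exact ihS _ _ (by omega) (by omega) (by omega) wM

theorem determinize_exec_iff (hA : A.PostForm) (hω : ω.IsWaveWord) {S S' : RefSet Q}
    (h : A.determinize.Exec ω S S') (r₁ : Q ⊕ (Q × Q × Q)) (r₂ q' : Q) :
    (r₁, r₂, q') ∈ S' ↔ ∃ q, (r₁, r₂, q) ∈ S ∧ A.Exec ω q q' := by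
  obtain ⟨D, h₁, h₂, hr, rfl, rfl⟩ := h
  rw [(captures_of_size_lt hω hr.tracks (ω.word.length + 1)).1 0 ω.word.length (Nat.zero_le _)
    le_rfl (by omega) ⟨wpa_Ioc_zero, wpa_Ioc_zero⟩ r₁ r₂ q']
  simp only [hA.exec_iff, FromState]
  constructor
  · rintro ⟨ℓ, h0, hℓ, e⟩
    exact ⟨_, h0, ℓ, rfl, hℓ, e⟩
  · rintro ⟨_, h0, ℓ, rfl, hℓ, e⟩
    exact ⟨ℓ, h0, hℓ, e⟩

end Correctness

end TwoNWA

/-- correctness invariant of the determinization construction.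
For a post-form 2NWA `A`, there is a deterministic and complete 2NWA `A'` whose
linear states are sets of triples in `(Q ⊕ Q³) × Q × Q`, with the prescribed
initial state, such that on every wpa interval of a 2-wave word, the runs of
`A'` exactly capture the runs of `A` together with their reference states. -/
theorem determinization_invariant (α Q : Type) [Finite α] [Finite Q]
    (A : TwoNWA α Q Q) (hA : A.PostForm) :
    ∃ (P' : Type) (A' : TwoNWA α (Set ((Q ⊕ (Q × Q × Q)) × Q × Q)) P'),
      A'.Deterministic ∧ A'.Complete ∧
      A'.init = { S | S = { x | ∃ q0 ∈ A.init, x = (Sum.inl q0, q0, q0) } } ∧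
      ∀ ω : TwoNW α, ω.IsWaveWord →
        ∀ s f : ℕ, 1 ≤ s → f ≤ ω.word.length → ω.WpaSet (Set.Icc s f) →
          ∀ S S' : Set ((Q ⊕ (Q × Q × Q)) × Q × Q),
            A'.Exec (ω.restrict s f) S S' →
            ∀ (r₁ : Q ⊕ (Q × Q × Q)) (r₂ q' : Q),
              ((r₁, r₂, q') ∈ S' ↔
                ∃ q, (r₁, r₂, q) ∈ S ∧ A.Exec (ω.restrict s f) q q') := by
  refine ⟨_, A.determinize, A.determinize_deterministic, A.determinize_complete, rfl, ?_⟩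
  intro ω hω s f hs hf hI S S' h r₁ r₂ q'
  exact TwoNWA.determinize_exec_iff hA (hω.restrict hs hf hI) h r₁ r₂ q'
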